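/- For every integer n ≥ 1, the following identity holds in ℚ(q): ∑_{r=0}^{n} (-1)^r q^{r(r+1)/2} (-q;q)_{n-r} [2n-r+1 choose r]_q = ∑_{m=-⌊n/2⌋}^{⌊(n+1)/2⌋} (-1)^m q^{m(3m-1)}. -/

import Mathlib

open Finset

/-- The indeterminate `q`, as an element of the field `ℚ(q)` of rational functions. -/
noncomputable def q : RatFunc ℚ := RatFunc.X

/-- The q-Pochhammer symbol `(a; q)_n` for a nonnegative integer `n`. -/
noncomputable def qPoch (a : RatFunc ℚ) (n : ℕ) : RatFunc ℚ :=
  ∏ k ∈ Finset.range n, (1 - a * q ^ k)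

/-- The q-Pochhammer symbol `(a; q)_n` for an arbitrary integer `n`, where for `n > 0`
`(a; q)_{-n} = 1 / (a q^{-n}; q)_n`. -/
noncomputable def qPochZ (a : RatFunc ℚ) (n : ℤ) : RatFunc ℚ :=
  if 0 ≤ n then qPoch a n.toNat else 1 / qPoch (a * q ^ n) (-n).toNat

/-- The Gaussian (q-)binomial coefficient `[n choose m]_q`, equal to
`(q;q)_n / ((q;q)_m (q;q)_{n-m})` for `0 ≤ m ≤ n` and `0` otherwise. -/
noncomputable def qbinom (n m : ℤ) : RatFunc ℚ :=
  if 0 ≤ m ∧ m ≤ n then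
    qPoch q n.toNat / (qPoch q m.toNat * qPoch q (n - m).toNat)
  else 0

lemma q_ne_zero : q ≠ 0 := RatFunc.X_ne_zero

lemma one_sub_q_pow_ne_zero (k : ℕ) : 1 - q * q ^ k ≠ 0 := by
  intro h
  have h1 : algebraMap (Polynomial ℚ) (RatFunc ℚ) (Polynomial.X ^ (k + 1)) =
      algebraMap (Polynomial ℚ) (RatFunc ℚ) 1 := by
    rw [map_pow, map_one, RatFunc.algebraMap_X, pow_succ']
    exact (sub_eq_zero.mp h).symm
  have h2 := congrArg Polynomial.natDegree (RatFunc.algebraMap_injective ℚ h1)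
  simp at h2

lemma qPoch_succ (a : RatFunc ℚ) (n : ℕ) : qPoch a (n + 1) = qPoch a n * (1 - a * q ^ n) :=
  Finset.prod_range_succ _ _

lemma qPoch_q_ne_zero (n : ℕ) : qPoch q n ≠ 0 :=
  Finset.prod_ne_zero_iff.mpr fun k _ => one_sub_q_pow_ne_zero k

lemma qbinom_add (a b : ℕ) :
    qbinom ((a : ℤ) + b) a = qPoch q (a + b) / (qPoch q a * qPoch q b) := by
  have h : (a : ℤ) + b = ((a + b : ℕ) : ℤ) := by push_cast; ring
  rw [qbinom, if_pos (by lia), add_sub_cancel_left, h, Int.toNat_natCast, Int.toNat_natCast,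
    Int.toNat_natCast]

lemma qbinom_of_neg {n m : ℤ} (h : m < 0) : qbinom n m = 0 := if_neg (by lia)

lemma qbinom_of_lt {n m : ℤ} (h : n < m) : qbinom n m = 0 := if_neg (by lia)

lemma qbinom_zero (n : ℕ) : qbinom n 0 = 1 := by
  have h := qbinom_add 0 n
  have h0 := qPoch_q_ne_zero n
  simpa [qPoch, h0, div_self (show ∏ k ∈ range n, (1 - q * q ^ k) ≠ 0 from h0)] using h

lemma qbinom_symm (n m : ℤ) : qbinom n m = qbinom n (n - m) := by
  unfold qbinom
  by_cases h : 0 ≤ m ∧ m ≤ n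
  · rw [if_pos h, if_pos (by lia), sub_sub_cancel, mul_comm (qPoch q m.toNat)]
  · rw [if_neg h, if_neg (by lia)]

lemma qbinom_self (n : ℕ) : qbinom n n = 1 := by
  rw [qbinom_symm, sub_self, qbinom_zero]

/-- The `q`-Pascal rule. -/
lemma qbinom_succ (n : ℕ) (m : ℤ) :
    qbinom ((n : ℤ) + 1) m = qbinom n (m - 1) + q ^ m * qbinom n m := by
  rcases lt_trichotomy m 0 with hm | rfl | hm
  · rw [qbinom_of_neg hm, qbinom_of_neg hm, qbinom_of_neg (by lia)]; simp
  · rw [qbinom_of_neg (m := 0 - 1) (by lia), qbinom_zero]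
    have := qbinom_zero (n + 1)
    push_cast at this
    simp [this]
  rcases lt_trichotomy m (n + 1) with hn | rfl | hn
  · obtain ⟨a, rfl⟩ : ∃ a : ℕ, m = a + 1 := ⟨(m - 1).toNat, by lia⟩
    obtain ⟨b, rfl⟩ : ∃ b : ℕ, n = a + 1 + b := ⟨n - (a + 1), by lia⟩
    have e1 := qbinom_add (a + 1) (b + 1)
    have e2 := qbinom_add a (b + 1)
    have e3 := qbinom_add (a + 1) b
    push_cast at e1 e2 e3 ⊢
    rw [show (a : ℤ) + 1 + b + 1 = a + 1 + (b + 1) by ring, e1, e3, add_sub_cancel_right,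
      show (a : ℤ) + 1 + b = a + (b + 1) by ring, e2,
      show a + 1 + (b + 1) = a + b + 1 + 1 by ring, show a + (b + 1) = a + b + 1 by ring,
      show a + 1 + b = a + b + 1 by ring, qPoch_succ q (a + b + 1), qPoch_succ q a, qPoch_succ q b]
    have h1 := qPoch_q_ne_zero a
    have h2 := qPoch_q_ne_zero b
    have h3 := one_sub_q_pow_ne_zero a
    have h4 := one_sub_q_pow_ne_zero b
    rw [show (a : ℤ) + 1 = ((a + 1 : ℕ) : ℤ) by push_cast; ring, zpow_natCast]
    field_simp
    ring
  · rw [qbinom_of_lt (n := n) (m := n + 1) (by lia), add_sub_cancel_right, qbinom_self]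
    have := qbinom_self (n + 1)
    push_cast at this
    simp [this]
  · rw [qbinom_of_lt hn, qbinom_of_lt (by lia), qbinom_of_lt (by lia)]; simp

/-- The `q`-Pascal rule, in its reflected form. -/
lemma qbinom_succ' (n : ℕ) (m : ℤ) :
    qbinom ((n : ℤ) + 1) m = qbinom n m + q ^ ((n : ℤ) + 1 - m) * qbinom n (m - 1) := by
  rw [qbinom_symm, qbinom_succ, qbinom_symm n m, qbinom_symm n (m - 1),
    show (n : ℤ) + 1 - m - 1 = n - m by ring, show (n : ℤ) - (m - 1) = n + 1 - m by ring]

/-- The bilateral sum `∑_m (-1)^m q^(3m² + cm) [N choose a + 2m]`. -/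
noncomputable def bilateralSum (N a c : ℤ) : RatFunc ℚ :=
  ∑ᶠ m : ℤ, (-1) ^ m * q ^ (3 * m ^ 2 + c * m) * qbinom N (a + 2 * m)

lemma support_bilateralSum_subset (N a c : ℤ) :
    (Function.support fun m : ℤ => (-1 : RatFunc ℚ) ^ m * q ^ (3 * m ^ 2 + c * m) *
      qbinom N (a + 2 * m)) ⊆ {m | 0 ≤ a + 2 * m ∧ a + 2 * m ≤ N} := by
  intro m hm
  by_contra h
  exact hm (by simp [qbinom, show ¬(0 ≤ a + 2 * m ∧ a + 2 * m ≤ N) from h])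

lemma finite_support_bilateralSum (N a c : ℤ) :
    (Function.support fun m : ℤ => (-1 : RatFunc ℚ) ^ m * q ^ (3 * m ^ 2 + c * m) *
      qbinom N (a + 2 * m)).Finite := by
  refine (Set.finite_Icc (-|a| - |N|) (|a| + |N|)).subset fun m hm => ?_
  have h := support_bilateralSum_subset N a c hm
  simp only [Set.mem_ofPred_eq] at h
  rw [Set.mem_Icc]
  have ha := abs_nonneg a
  have hN := le_abs_self N
  have ha' := neg_abs_le a
  have ha'' := le_abs_self a
  have hN' := abs_nonneg N
  lia

lemma bilateralSum_eq_add_mul {N a c N₁ a₁ c₁ N₂ a₂ c₂ : ℤ} {x : RatFunc ℚ}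
    (h : ∀ m : ℤ, q ^ (3 * m ^ 2 + c * m) * qbinom N (a + 2 * m) =
      q ^ (3 * m ^ 2 + c₁ * m) * qbinom N₁ (a₁ + 2 * m) +
        x * (q ^ (3 * m ^ 2 + c₂ * m) * qbinom N₂ (a₂ + 2 * m))) :
    bilateralSum N a c = bilateralSum N₁ a₁ c₁ + x * bilateralSum N₂ a₂ c₂ := by
  unfold bilateralSum
  rw [mul_finsum, ← finsum_add_distrib
    (finite_support_bilateralSum N₁ a₁ c₁)
    ((finite_support_bilateralSum N₂ a₂ c₂).subset fun _ => right_ne_zero_of_mul)]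
  refine finsum_congr fun m => ?_
  rw [mul_assoc, h m]
  ring

lemma bilateralSum_succ (N : ℕ) (a c : ℤ) :
    bilateralSum (N + 1) a c = bilateralSum N (a - 1) c + q ^ a * bilateralSum N a (c + 2) := by
  refine bilateralSum_eq_add_mul fun m => ?_
  rw [qbinom_succ, mul_add, show a + 2 * m - 1 = a - 1 + 2 * m by ring, ← mul_assoc, ← mul_assoc,
    ← zpow_add₀ q_ne_zero, ← zpow_add₀ q_ne_zero]
  congr 3
  ring

lemma bilateralSum_succ' (N : ℕ) (a c : ℤ) :
    bilateralSum (N + 1) a c =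
      bilateralSum N a c + q ^ ((N : ℤ) + 1 - a) * bilateralSum N (a - 1) (c - 2) := by
  refine bilateralSum_eq_add_mul fun m => ?_
  rw [qbinom_succ', mul_add, show a + 2 * m - 1 = a - 1 + 2 * m by ring, ← mul_assoc, ← mul_assoc,
    ← zpow_add₀ q_ne_zero, ← zpow_add₀ q_ne_zero]
  congr 3
  ring

lemma bilateralSum_symm (N a c : ℤ) : bilateralSum N a c = bilateralSum N (N - a) (-c) := by
  unfold bilateralSum
  rw [← finsum_comp_equiv (Equiv.neg ℤ)]
  refine finsum_congr fun m => ?_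
  simp only [Equiv.neg_apply]
  rw [qbinom_symm, zpow_neg, ← inv_zpow, inv_neg_one]
  congr 2 <;> congr 1 <;> ring

lemma bilateralSum_shift (N a c : ℤ) :
    bilateralSum N a c = -(q ^ (3 + c) * bilateralSum N (a + 2) (c + 6)) := by
  unfold bilateralSum
  rw [← finsum_comp_equiv (Equiv.addRight (1 : ℤ)),
    mul_finsum, ← finsum_neg_distrib]
  refine finsum_congr fun m => ?_
  simp only [Equiv.coe_addRight]
  rw [zpow_add_one₀ (by simp), show 3 * (m + 1) ^ 2 + c * (m + 1) =
    (3 + c) + (3 * m ^ 2 + (c + 6) * m) by ring, zpow_add₀ q_ne_zero,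
    show a + 2 * (m + 1) = a + 2 + 2 * m by ring]
  ring

lemma bilateralSum_two_mul_sub_one (s : ℤ) : bilateralSum (2 * s) (s - 1) (-3) = 0 := by
  have h := bilateralSum_shift (2 * s) (s - 1) (-3)
  rw [bilateralSum_symm _ (s - 1 + 2), show 2 * s - (s - 1 + 2) = s - 1 by ring] at h
  norm_num at h
  exact self_eq_neg.mp h

lemma bilateralSum_two_mul_add_one (s : ℕ) :
    bilateralSum (2 * s + 1) s (-1) = bilateralSum (2 * s) s (-1) := by
  have h := bilateralSum_succ' (2 * s) s (-1)
  push_cast at h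
  rw [h, bilateralSum_two_mul_sub_one, mul_zero, add_zero]

lemma bilateralSum_two_mul_succ (s : ℕ) :
    bilateralSum (2 * ((s + 1 : ℕ) : ℤ)) (s + 1 : ℕ) (-1) =
      (1 + q ^ (s + 1)) * bilateralSum (2 * s + 1) s (-1) := by
  have h := bilateralSum_succ (2 * s + 1) (s + 1) (-1)
  push_cast at h ⊢
  rw [show 2 * ((s : ℤ) + 1) = 2 * s + 1 + 1 by ring, h,
    bilateralSum_symm _ (s + 1) 1, show (2 * (s : ℤ) + 1 - (s + 1)) = s by ring,
    add_sub_cancel_right, show (s : ℤ) + 1 = ((s + 1 : ℕ) : ℤ) by push_cast; ring, zpow_natCast]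
  ring

lemma bilateralSum_zero : bilateralSum 0 0 (-1) = 1 := by
  unfold bilateralSum
  rw [finsum_eq_single _ 0]
  · simpa using qbinom_zero 0
  · intro m hm
    rw [qbinom, if_neg (by lia), mul_zero]

/-- `(-q; q)_s = ∑_m (-1)^m q^(m(3m-1)) [2s+1 choose s+2m]`. -/
lemma qPoch_neg_q_eq_bilateralSum (s : ℕ) :
    qPoch (-q) s = bilateralSum (2 * s + 1) s (-1) := by
  induction s with
  | zero =>
    rw [bilateralSum_two_mul_add_one]
    simp [qPoch, bilateralSum_zero]
  | succ s ih =>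
    rw [bilateralSum_two_mul_add_one, bilateralSum_two_mul_succ, ← ih, qPoch_succ]
    ring

/-- The alternating sum `∑_t (-1)^t q^(t(t+1)/2) [N choose t] f(N - t)`, which is
`∏_{i=1}^N (E - q^i)` applied to `f` at `0`, where `E` is the forward shift. -/
noncomputable def qDiff (N : ℕ) (f : ℕ → RatFunc ℚ) : RatFunc ℚ :=
  ∑ t ∈ range (N + 1), (-1) ^ t * q ^ (t * (t + 1) / 2) * qbinom N t * f (N - t)

lemma qDiff_succ (N : ℕ) (f : ℕ → RatFunc ℚ) :
    qDiff (N + 1) f = qDiff N fun t => f (t + 1) - q ^ (N + 1) * f t := by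
  have tri (t : ℕ) : (t + 1) * (t + 1 + 1) / 2 = t * (t + 1) / 2 + (t + 1) := by
    rw [show (t + 1) * (t + 1 + 1) = t * (t + 1) + (t + 1) * 2 by ring,
      Nat.add_mul_div_right _ _ two_pos]
  have h1 : qDiff (N + 1) f =
      ∑ t ∈ range (N + 2), (-1) ^ t * q ^ (t * (t + 1) / 2) * qbinom N t * f (N + 1 - t) +
      ∑ t ∈ range (N + 2), (-1) ^ t * q ^ (t * (t + 1) / 2) *
        (q ^ ((N : ℤ) + 1 - t) * qbinom N ((t : ℤ) - 1)) * f (N + 1 - t) := by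
    rw [qDiff, ← sum_add_distrib]
    refine sum_congr rfl fun t _ => ?_
    push_cast
    rw [qbinom_succ']
    ring
  rw [h1, sum_range_succ, sum_range_succ' _ (N + 1), qbinom_of_lt (m := (N + 1 : ℕ)) (by simp),
    qbinom_of_neg (m := ((0 : ℕ) : ℤ) - 1) (by simp), qDiff]
  simp only [mul_zero, zero_mul, add_zero]
  rw [← sum_add_distrib]
  refine sum_congr rfl fun t ht => ?_
  have ht : t ≤ N := by simpa [Nat.lt_succ_iff] using ht
  rw [tri, show N + 1 - t = N - t + 1 by lia, show N + 1 - (t + 1) = N - t by lia,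
    show (N : ℤ) + 1 - ((t + 1 : ℕ) : ℤ) = ((N - t : ℕ) : ℤ) by lia, zpow_natCast,
    show ((t + 1 : ℕ) : ℤ) - 1 = t by lia,
    show q ^ (N + 1) = q ^ (t + 1) * q ^ (N - t) by rw [← pow_add]; congr 1; lia]
  ring

lemma qDiff_qbinom (N K : ℕ) : qDiff N (fun t => qbinom ((K + t : ℕ) : ℤ) N) = 1 := by
  induction N with
  | zero => simp [qDiff, qbinom_zero, show qbinom 0 0 = 1 from qbinom_zero 0]
  | succ N ih =>
    rw [qDiff_succ, ← ih]
    congr 1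
    funext t
    have h := qbinom_succ (K + t) ((N + 1 : ℕ) : ℤ)
    rw [zpow_natCast] at h
    push_cast at h ⊢
    rw [← add_assoc, h]
    ring_nf

lemma qbinom_mul_qbinom (j t u : ℕ) :
    qbinom (2 * ((j + (t + u) : ℕ) : ℤ) - t + 1) t *
        qbinom (2 * ((j + u : ℕ) : ℤ) + 1) ((j + u : ℕ) - (j : ℤ)) =
      qbinom ((t + u : ℕ) : ℤ) t * qbinom ((t + u + 2 * j + 1 + u : ℕ) : ℤ) (t + u : ℕ) := by
  have e1 := qbinom_add t (2 * j + 2 * u + 1)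
  have e2 := qbinom_add u (2 * j + u + 1)
  have e3 := qbinom_add t u
  have e4 := qbinom_add (t + u) (2 * j + u + 1)
  rw [show 2 * ((j + (t + u) : ℕ) : ℤ) - t + 1 = t + (2 * j + 2 * u + 1 : ℕ) by push_cast; ring, e1,
    show 2 * ((j + u : ℕ) : ℤ) + 1 = u + (2 * j + u + 1 : ℕ) by push_cast; ring,
    show ((j + u : ℕ) - (j : ℤ)) = u by push_cast; ring, e2,
    show ((t + u : ℕ) : ℤ) = t + u by push_cast; ring, e3,
    show ((t + u + 2 * j + 1 + u : ℕ) : ℤ) = (t + u : ℕ) + (2 * j + u + 1 : ℕ) by push_cast; ring,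
    show (t : ℤ) + u = (t + u : ℕ) by push_cast; ring, e4,
    show u + (2 * j + u + 1) = 2 * j + 2 * u + 1 by ring,
    show t + (2 * j + 2 * u + 1) = t + u + (2 * j + u + 1) by ring]
  have h1 := qPoch_q_ne_zero t
  have h2 := qPoch_q_ne_zero u
  have h3 := qPoch_q_ne_zero (t + u)
  have h4 := qPoch_q_ne_zero (2 * j + u + 1)
  have h5 := qPoch_q_ne_zero (2 * j + 2 * u + 1)
  field_simp

lemma sum_qbinom_mul_qbinom {n j : ℕ} (hj : j ≤ n) :
    ∑ r ∈ range (n + 1), (-1 : RatFunc ℚ) ^ r * q ^ (r * (r + 1) / 2) *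
      (qbinom (2 * (n : ℤ) - r + 1) r * qbinom (2 * ((n - r : ℕ) : ℤ) + 1)
        ((n - r : ℕ) - (j : ℤ))) = 1 := by
  obtain ⟨N, rfl⟩ := Nat.exists_eq_add_of_le hj
  refine Eq.trans (Eq.symm ?_) (qDiff_qbinom N (N + 2 * j + 1))
  refine sum_subset_zero_on_sdiff (range_subset_range.mpr (by lia)) (fun r hr => ?_)
    fun r hr => ?_
  · simp only [mem_sdiff, mem_range] at hr
    rw [qbinom_of_neg (m := ((j + N - r : ℕ) - (j : ℤ))) (by lia), mul_zero, mul_zero]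
  · obtain ⟨u, rfl⟩ : ∃ u, N = r + u := ⟨N - r, by simp at hr; lia⟩
    have h := qbinom_mul_qbinom j r u
    rw [show j + (r + u) - r = j + u by lia, h, add_tsub_cancel_left, ← mul_assoc]

/-- Theorem 2.5: for `n ≥ 1`,
`∑_{r=0}^n (-1)^r q^(r(r+1)/2) (-q;q)_(n-r) [2n-r+1, r]_q
  = ∑_{m=-⌊n/2⌋}^{⌊(n+1)/2⌋} (-1)^m q^(m(3m-1))`. -/
theorem truncated_gauss_bilateral (n : ℕ) (hn : 1 ≤ n) :
    ∑ r ∈ Finset.range (n + 1),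
      (-1 : RatFunc ℚ) ^ r * q ^ (r * (r + 1) / 2) * qPoch (-q) (n - r) *
        qbinom (2 * (n : ℤ) - r + 1) r =
    ∑ m ∈ Finset.Icc (-((n / 2 : ℕ) : ℤ)) (((n + 1) / 2 : ℕ) : ℤ),
      (-1 : RatFunc ℚ) ^ m * q ^ (m * (3 * m - 1)) := by
  have hP (r : ℕ) : qPoch (-q) (n - r) =
      ∑ m ∈ Finset.Icc (-((n / 2 : ℕ) : ℤ)) (((n + 1) / 2 : ℕ) : ℤ),
        (-1 : RatFunc ℚ) ^ m * q ^ (3 * m ^ 2 + -1 * m) *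
          qbinom (2 * ((n - r : ℕ) : ℤ) + 1) ((n - r : ℕ) + 2 * m) := by
    rw [qPoch_neg_q_eq_bilateralSum, bilateralSum]
    refine finsum_eq_sum_of_support_subset _ fun m hm => ?_
    have h := support_bilateralSum_subset _ _ _ hm
    simp only [Set.mem_ofPred_eq] at h
    rw [Finset.coe_Icc, Set.mem_Icc]
    lia
  simp only [hP, mul_sum, sum_mul]
  rw [sum_comm]
  refine sum_congr rfl fun m hm => ?_
  rw [Finset.mem_Icc] at hm
  obtain ⟨j, hj, hjm⟩ : ∃ j : ℕ, j ≤ n ∧ ∀ s : ℤ,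
      qbinom (2 * s + 1) (s + 2 * m) = qbinom (2 * s + 1) (s - j) := by
    rcases le_or_gt m 0 with h | h
    · exact ⟨(-2 * m).toNat, by lia, fun s => by congr 1; lia⟩
    · exact ⟨(2 * m - 1).toNat, by lia, fun s => by rw [qbinom_symm]; congr 1; lia⟩
  refine Eq.trans ?_ ((congrArg _ (sum_qbinom_mul_qbinom hj)).trans (mul_one _))
  rw [mul_sum]
  refine sum_congr rfl fun r _ => ?_
  rw [hjm, show m * (3 * m - 1) = 3 * m ^ 2 + -1 * m by ring]
  ring
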